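/- (Gronwall-type lemma.) Let 1 ≤ p ≤ q with 1/p + 1/q > 1, let T > 0, let ω : [0,T] → ℝ be continuous of finite p-variation and y : [0,T] → ℝ^d continuous of finite q-variation. Assume there exist a control function A on Δ[0,T] and constants a_1, a_2 ≥ 0 such that |y_t − y_s| ≤ A(s,t)^{1/q} + a_1 |∫_s^t y_u du| + a_2 |∫_s^t y_u dω_u| for all 0 ≤ s < t ≤ T. Then there exists a constant C, depending only on p, q, a_1, a_2 (in particular independent of T), such that for all 0 ≤ s < t ≤ T, |||y|||_{q-var,[s,t]} ≤ (2A_0 + |y_s|) · exp( C·( |t − s|^p + |||ω|||^p_{p-var,[s,t]} ) ), where A_0 := A(0,T)^{1/q}. -/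

import Mathlib

open scoped BigOperators
open Set

noncomputable section

/-- Euclidean space `ℝ^n`. -/
abbrev Ed (n : ℕ) : Type := EuclideanSpace ℝ (Fin n)

section PVarDefs

variable {E F : Type*} [NormedAddCommGroup E] [NormedSpace ℝ E]
  [NormedAddCommGroup F] [NormedSpace ℝ F]

/-- The set of sums `Σ_i ‖x (t (i+1)) - x (t i)‖ ^ p` over all finite partitions
`a = t 0 < t 1 < ⋯ < t n = b` of `[a,b]`. -/
def pVarSums (p : ℝ) (x : ℝ → E) (a b : ℝ) : Set ℝ :=
  { v | ∃ n : ℕ, ∃ t : Fin (n + 1) → ℝ, StrictMono t ∧ t 0 = a ∧ t (Fin.last n) = b ∧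
      v = ∑ i : Fin n, ‖x (t i.succ) - x (t i.castSucc)‖ ^ p }

/-- The `p`-variation seminorm `|||x|||_{p-var,[a,b]}`. -/
def pVar (p : ℝ) (x : ℝ → E) (a b : ℝ) : ℝ :=
  sSup (pVarSums p x a b) ^ (1 / p)

/-- `x` is of finite `p`-variation on `[a,b]`. -/
def FinitePVar (p : ℝ) (x : ℝ → E) (a b : ℝ) : Prop :=
  BddAbove (pVarSums p x a b)

/-- The `p`-variation norm `‖x‖_{p-var,[a,b]} = ‖x a‖ + |||x|||_{p-var,[a,b]}`. -/
def pVarNorm (p : ℝ) (x : ℝ → E) (a b : ℝ) : ℝ :=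
  ‖x a‖ + pVar p x a b

/-- A control function on `[a,b]`: continuous on the simplex, vanishing on the diagonal,
superadditive and nonnegative. -/
def IsControlOn (a b : ℝ) (w : ℝ → ℝ → ℝ) : Prop :=
  ContinuousOn (fun pr : ℝ × ℝ => w pr.1 pr.2) {pr : ℝ × ℝ | a ≤ pr.1 ∧ pr.1 ≤ pr.2 ∧ pr.2 ≤ b} ∧
  (∀ t : ℝ, a ≤ t → t ≤ b → w t t = 0) ∧
  (∀ s t u : ℝ, a ≤ s → s ≤ t → t ≤ u → u ≤ b → w s t + w t u ≤ w s u) ∧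
  (∀ s t : ℝ, a ≤ s → s ≤ t → t ≤ b → 0 ≤ w s t)

/-- A tagged partition `a = t 0 < t 1 < ⋯ < t n = b` of `[a,b]`, with tags
`tag i ∈ [t i, t (i+1)]`. -/
structure TaggedPartition (a b : ℝ) where
  n : ℕ
  t : Fin (n + 1) → ℝ
  tag : Fin n → ℝ
  mono : StrictMono t
  first : t 0 = a
  last : t (Fin.last n) = b
  tag_mem : ∀ i : Fin n, tag i ∈ Set.Icc (t i.castSucc) (t i.succ)

/-- The mesh of a tagged partition. -/
def TaggedPartition.mesh {a b : ℝ} (P : TaggedPartition a b) : ℝ :=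
  ⨆ i : Fin P.n, (P.t i.succ - P.t i.castSucc)

/-- Riemann–Stieltjes sum of `x` against `ω` along a tagged partition. -/
def RSSum (x : ℝ → E →L[ℝ] F) (ω : ℝ → E) {a b : ℝ} (P : TaggedPartition a b) : F :=
  ∑ i : Fin P.n, x (P.tag i) (ω (P.t i.succ) - ω (P.t i.castSucc))

/-- `v` is the Young integral `∫_a^b x dω`: the Riemann–Stieltjes sums converge to `v`
as the mesh tends to `0`. -/
def IsYoungIntegral (x : ℝ → E →L[ℝ] F) (ω : ℝ → E) (a b : ℝ) (v : F) : Prop :=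
  ∀ ε : ℝ, 0 < ε → ∃ δ : ℝ, 0 < δ ∧
    ∀ P : TaggedPartition a b, P.mesh < δ → ‖RSSum x ω P - v‖ < ε

/-- The Young integral `∫_a^b x dω` (an arbitrary value, `0`, if the limit does not exist). -/
def youngIntegral (x : ℝ → E →L[ℝ] F) (ω : ℝ → E) (a b : ℝ) : F :=
  letI := Classical.propDecidable (∃ v, IsYoungIntegral x ω a b v)
  if hv : ∃ v, IsYoungIntegral x ω a b v then hv.choose else 0

end PVarDefs

section VariationSums

variable {E : Type*} [NormedAddCommGroup E]

/-- Inductive description of the `p`-variation sums over partitions of `[a, b]`. -/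
inductive VariationSum (p : ℝ) (x : ℝ → E) (a : ℝ) : ℝ → ℝ → Prop
  | nil : VariationSum p x a a 0
  | snoc {b c v : ℝ} (h : VariationSum p x a b v) (hbc : b < c) :
      VariationSum p x a c (v + ‖x c - x b‖ ^ p)

theorem mem_pVarSums_iff {p : ℝ} {x : ℝ → E} {a b v : ℝ} :
    v ∈ pVarSums p x a b ↔ VariationSum p x a b v := by
  constructor
  · rintro ⟨n, t, ht, rfl, hb, rfl⟩
    induction n generalizing b with
    | zero =>
      have : b = t 0 := by rw [← hb]; rfl
      subst this
      simpa using VariationSum.nil (p := p) (x := x) (a := t 0)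
    | succ n ih =>
      have h := ih (t ∘ Fin.castSucc) (ht.comp Fin.strictMono_castSucc) (b := _) rfl
      rw [Fin.sum_univ_castSucc]
      subst hb
      exact h.snoc (ht (Fin.castSucc_lt_last _))
  · intro h
    induction h with
    | nil => exact ⟨0, fun _ => a, Subsingleton.strictMono (α := Fin 1) _, rfl, rfl, by simp⟩
    | @snoc b c v h hbc ih =>
      obtain ⟨n, t, ht, ha, hb, rfl⟩ := ih
      refine ⟨n + 1, Fin.snoc t c, ?_, ?_, by simp, ?_⟩
      · rw [Fin.strictMono_iff_lt_succ]
        intro i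
        induction i using Fin.lastCases with
        | last => simpa [hb] using hbc
        | cast i =>
          rw [← Fin.castSucc_succ, Fin.snoc_castSucc, Fin.snoc_castSucc]
          exact ht (Fin.castSucc_lt_succ)
      · rw [← ha, ← Fin.castSucc_zero, Fin.snoc_castSucc]
      · rw [Fin.sum_univ_castSucc]
        simp only [← Fin.castSucc_succ, Fin.snoc_castSucc, Fin.succ_last, Fin.snoc_last, hb]

namespace VariationSum

variable {p : ℝ} {x : ℝ → E} {a b c v w : ℝ}

theorem le (h : VariationSum p x a b v) : a ≤ b := by
  induction h with
  | nil => exact le_rfl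
  | snoc _ hbc ih => exact ih.trans hbc.le

theorem nonneg (h : VariationSum p x a b v) : 0 ≤ v := by
  induction h with
  | nil => exact le_rfl
  | snoc _ _ ih => positivity

theorem append (h : VariationSum p x a b v) (h' : VariationSum p x b c w) :
    VariationSum p x a c (v + w) := by
  induction h' with
  | nil => simpa using h
  | snoc _ hbc ih => rw [← add_assoc]; exact ih.snoc hbc

theorem single (h : a < b) : VariationSum p x a b (‖x b - x a‖ ^ p) := by
  simpa using (nil (p := p) (x := x) (a := a)).snoc h

theorem eq_zero (h : VariationSum p x a a v) : v = 0 := by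
  cases h with
  | nil => rfl
  | snoc h hbc => exact absurd h.le (not_le.2 hbc)

theorem exists_cons (h : VariationSum p x a b v) (hab : a < b) :
    ∃ c w, a < c ∧ VariationSum p x c b w ∧ v = ‖x c - x a‖ ^ p + w := by
  induction h with
  | nil => exact absurd hab (lt_irrefl _)
  | @snoc b c v h hbc ih =>
    rcases h.le.eq_or_lt with rfl | hlt
    · exact ⟨c, 0, hab, nil, by rw [h.eq_zero]; ring⟩
    · obtain ⟨e, w, hae, hw, rfl⟩ := ih hlt
      exact ⟨e, _, hae, hw.snoc hbc, by ring⟩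

/-- A variation sum is dominated by any superadditive functional dominating its terms. -/
theorem le_of_superadditive {W : ℝ → ℝ → ℝ} {s t : ℝ} (h : VariationSum p x s b v)
    (hbt : b ≤ t) (hW0 : 0 ≤ W s s)
    (hadd : ∀ u ∈ Icc s t, ∀ u' ∈ Icc s t, u ≤ u' → W s u + W u u' ≤ W s u')
    (hle : ∀ u ∈ Icc s t, ∀ u' ∈ Icc s t, u < u' → ‖x u' - x u‖ ^ p ≤ W u u') :
    v ≤ W s b := by
  induction h with
  | nil => exact hW0
  | @snoc b c v h hbc ih =>
    have hb : b ∈ Icc s t := ⟨h.le, hbc.le.trans hbt⟩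
    have hc : c ∈ Icc s t := ⟨h.le.trans hbc.le, hbt⟩
    linarith [ih hb.2, hadd b hb c hc hbc.le, hle b hb c hc hbc]

end VariationSum

/-- The `p`-th power of the `p`-variation. -/
def powVar (p : ℝ) (x : ℝ → E) (a b : ℝ) : ℝ := sSup (pVarSums p x a b)

variable {p : ℝ} {x : ℝ → E} {a b c s t : ℝ}

theorem powVar_nonneg : 0 ≤ powVar p x a b :=
  Real.sSup_nonneg fun _ hv => (mem_pVarSums_iff.1 hv).nonneg

theorem powVar_self : powVar p x a a = 0 :=
  le_antisymm (Real.sSup_le (fun _ hv => (mem_pVarSums_iff.1 hv).eq_zero.le) le_rfl) powVar_nonneg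

theorem exists_variationSum (h : a ≤ b) : ∃ v, VariationSum p x a b v := by
  rcases h.eq_or_lt with rfl | h
  · exact ⟨0, .nil⟩
  · exact ⟨_, .single h⟩

theorem FinitePVar.mono (h : FinitePVar p x a b) (hs : a ≤ s) (ht : t ≤ b) :
    FinitePVar p x s t := by
  obtain ⟨B, hB⟩ := h
  refine ⟨B, fun v hv => ?_⟩
  rw [mem_pVarSums_iff] at hv
  obtain ⟨v₁, h₁⟩ := exists_variationSum (p := p) (x := x) hs
  obtain ⟨v₂, h₂⟩ := exists_variationSum (p := p) (x := x) ht
  have := hB (mem_pVarSums_iff.2 ((h₁.append hv).append h₂))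
  linarith [h₁.nonneg, h₂.nonneg]

theorem VariationSum.le_powVar {v : ℝ} (h : VariationSum p x a b v) (hx : FinitePVar p x a b) :
    v ≤ powVar p x a b :=
  le_csSup hx (mem_pVarSums_iff.2 h)

theorem powVar_add_le (hx : FinitePVar p x a c) (hab : a ≤ b) (hbc : b ≤ c) :
    powVar p x a b + powVar p x b c ≤ powVar p x a c := by
  rw [← le_sub_iff_add_le]
  refine csSup_le ?_ fun v hv => ?_
  · obtain ⟨v, hv⟩ := exists_variationSum (p := p) (x := x) hab
    exact ⟨v, mem_pVarSums_iff.2 hv⟩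
  rw [le_sub_comm]
  refine csSup_le ?_ fun w hw => ?_
  · obtain ⟨v, hv⟩ := exists_variationSum (p := p) (x := x) hbc
    exact ⟨v, mem_pVarSums_iff.2 hv⟩
  rw [mem_pVarSums_iff] at hv hw
  linarith [(hv.append hw).le_powVar hx]

theorem powVar_mono (hx : FinitePVar p x a b) (hs : a ≤ s) (hst : s ≤ t) (ht : t ≤ b) :
    powVar p x s t ≤ powVar p x a b := by
  have h₁ := powVar_add_le hx (hs.trans hst) ht
  have h₂ := powVar_add_le (hx.mono le_rfl ht) hs hst
  linarith [powVar_nonneg (p := p) (x := x) (a := a) (b := s),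
    powVar_nonneg (p := p) (x := x) (a := t) (b := b)]

theorem norm_sub_le_powVar (hp : 0 < p) (hx : FinitePVar p x a b) (hab : a ≤ b) :
    ‖x b - x a‖ ≤ powVar p x a b ^ (1 / p) := by
  rw [one_div, Real.le_rpow_inv_iff_of_pos (norm_nonneg _) powVar_nonneg hp]
  rcases hab.eq_or_lt with rfl | h
  · simpa [Real.zero_rpow hp.ne'] using powVar_nonneg
  · exact (VariationSum.single h).le_powVar hx

/-- Minkowski's inequality for two pairs of `q`-th roots. -/
theorem minkowski_root_add {q : ℝ} (hq : 1 ≤ q) {a b a' b' : ℝ} (ha : 0 ≤ a) (hb : 0 ≤ b)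
    (ha' : 0 ≤ a') (hb' : 0 ≤ b') :
    (a ^ (1 / q) + b ^ (1 / q)) ^ q + (a' ^ (1 / q) + b' ^ (1 / q)) ^ q ≤
      ((a + a') ^ (1 / q) + (b + b') ^ (1 / q)) ^ q := by
  have hq0 : 0 < q := by linarith
  have hr : ∀ z : ℝ, 0 ≤ z → (z ^ (1 / q)) ^ q = z := fun z hz => by
    rw [← Real.rpow_mul hz, one_div_mul_cancel hq0.ne', Real.rpow_one]
  have := Real.Lp_add_le_of_nonneg (f := ![a ^ (1 / q), a' ^ (1 / q)])
    (g := ![b ^ (1 / q), b' ^ (1 / q)]) Finset.univ hq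
    (by intro i _; fin_cases i <;> simp <;> positivity)
    (by intro i _; fin_cases i <;> simp <;> positivity)
  simp only [Fin.sum_univ_two, Matrix.cons_val_zero, Matrix.cons_val_one,
    hr a ha, hr a' ha', hr b hb, hr b' hb'] at this
  rwa [one_div q, Real.rpow_inv_le_iff_of_pos (by positivity) (by positivity) hq0,
    ← one_div q] at this

/-- If the increments of `x` are bounded by the sum of the `q`-th roots of two superadditive
functionals, so is its `q`-variation. -/
theorem powVar_root_le_add {q : ℝ} (hq : 1 ≤ q) {W₁ W₂ : ℝ → ℝ → ℝ} (hst : s ≤ t)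
    (h₁ : ∀ u v, s ≤ u → u ≤ v → v ≤ t → 0 ≤ W₁ u v)
    (h₂ : ∀ u v, s ≤ u → u ≤ v → v ≤ t → 0 ≤ W₂ u v)
    (h₁' : ∀ u v, s ≤ u → u ≤ v → v ≤ t → W₁ s u + W₁ u v ≤ W₁ s v)
    (h₂' : ∀ u v, s ≤ u → u ≤ v → v ≤ t → W₂ s u + W₂ u v ≤ W₂ s v)
    (hx : ∀ u v, s ≤ u → u < v → v ≤ t →
      ‖x v - x u‖ ≤ W₁ u v ^ (1 / q) + W₂ u v ^ (1 / q)) :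
    powVar q x s t ^ (1 / q) ≤ W₁ s t ^ (1 / q) + W₂ s t ^ (1 / q) := by
  have hq0 : 0 < q := by linarith
  have hp₁ := h₁ s t le_rfl hst le_rfl
  have hp₂ := h₂ s t le_rfl hst le_rfl
  rw [one_div q, Real.rpow_inv_le_iff_of_pos powVar_nonneg (by positivity) hq0, ← one_div]
  refine Real.sSup_le (fun v hv => ?_) (by positivity)
  refine (mem_pVarSums_iff.1 hv).le_of_superadditive
    (W := fun u v => (W₁ u v ^ (1 / q) + W₂ u v ^ (1 / q)) ^ q) (t := t) le_rfl ?_ ?_ ?_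
  · have h₁ := h₁ s s le_rfl le_rfl hst
    have h₂ := h₂ s s le_rfl le_rfl hst
    positivity
  · intro u hu u' hu' huu
    have e₁ := h₁ s u le_rfl hu.1 hu.2
    have e₂ := h₂ s u le_rfl hu.1 hu.2
    have e₁' := h₁ u u' hu.1 huu hu'.2
    have e₂' := h₂ u u' hu.1 huu hu'.2
    refine (minkowski_root_add hq e₁ e₂ e₁' e₂').trans ?_
    have := h₁' u u' hu.1 huu hu'.2
    have := h₂' u u' hu.1 huu hu'.2
    gcongr
  · intro u hu u' hu' huu
    have := hx u u' hu.1 huu hu'.2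
    gcongr

theorem powVar_root_le_append {q : ℝ} (hq : 1 ≤ q) (hx : FinitePVar q x a c) (hab : a ≤ b)
    (hbc : b ≤ c) :
    powVar q x a c ^ (1 / q) ≤ powVar q x a b ^ (1 / q) + powVar q x b c ^ (1 / q) := by
  have hq0 : 0 < q := by linarith
  have key := powVar_root_le_add (x := x) hq (s := a) (t := c)
    (W₁ := fun u v => powVar q x (min u b) (min v b))
    (W₂ := fun u v => powVar q x (max u b) (max v b)) (hab.trans hbc)
    (fun _ _ _ _ _ => powVar_nonneg) (fun _ _ _ _ _ => powVar_nonneg)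
    (fun u v hu huv hv => powVar_add_le
      (hx.mono (le_min le_rfl hab)
        ((min_le_right _ _).trans hbc)) (min_le_min_right _ hu) (min_le_min_right _ huv))
    (fun u v hu huv hv => powVar_add_le
      (hx.mono (le_max_left _ _)
        (max_le hv hbc)) (max_le_max_right _ hu) (max_le_max_right _ huv))
    (fun u v hu huv hv => by
      have e₁ := norm_sub_le_powVar hq0 (hx.mono (le_min hu hab)
        ((min_le_right _ _).trans hbc)) (min_le_min_right b huv.le)
      have e₂ := norm_sub_le_powVar hq0 (hx.mono (hu.trans (le_max_left _ _))
        (max_le hv hbc)) (max_le_max_right b huv.le)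
      have : x v - x u = (x (min v b) - x (min u b)) + (x (max v b) - x (max u b)) := by
        rcases le_total u b with h | h <;> rcases le_total v b with h' | h' <;>
          simp [h, h']
      rw [this]
      exact (norm_add_le _ _).trans (add_le_add e₁ e₂))
  simpa [hab, hbc] using key

/-- Lower semicontinuity of the variation in the right endpoint. -/
theorem powVar_le_of_forall_lt {B : ℝ} (hp : 0 < p) (hx : ContinuousOn x (Icc a b))
    (hfin : FinitePVar p x a b) (hB : 0 ≤ B)
    (h : ∀ u, a ≤ u → u < b → powVar p x a u ≤ B) : powVar p x a b ≤ B := by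
  refine Real.sSup_le (fun v hv => ?_) hB
  cases mem_pVarSums_iff.1 hv with
  | nil => exact hB
  | @snoc c _ w hw hcb =>
    have hlim : Filter.Tendsto (fun u => w + ‖x u - x c‖ ^ p) (nhdsWithin b (Ioo c b))
        (nhds (w + ‖x b - x c‖ ^ p)) := by
      have : Filter.Tendsto x (nhdsWithin b (Ioo c b)) (nhds (x b)) :=
        (hx b ⟨hw.le.trans hcb.le, le_rfl⟩).mono_left
          (nhdsWithin_mono _ fun u hu => ⟨hw.le.trans hu.1.le, hu.2.le⟩)
      exact (((this.sub_const _).norm).rpow_const (Or.inr hp.le)).const_add _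
    have := right_nhdsWithin_Ioo_neBot hcb
    refine le_of_tendsto hlim (eventually_nhdsWithin_of_forall fun u hu => ?_)
    have hau := hw.le.trans hu.1.le
    exact ((hw.snoc hu.1).le_powVar (hfin.mono le_rfl hu.2.le)).trans (h u hau hu.2)

/-- Lower semicontinuity of the variation in the left endpoint. -/
theorem powVar_le_of_forall_gt {f : ℝ → ℝ} (hp : 0 < p) (hx : ContinuousOn x (Icc a b))
    (hfin : FinitePVar p x a b) (hf : ContinuousOn f (Icc a b)) (hf0 : 0 ≤ f a)
    (h : ∀ u, a < u → u ≤ b → powVar p x u b ≤ f u) : powVar p x a b ≤ f a := by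
  refine Real.sSup_le (fun v hv => ?_) hf0
  rw [mem_pVarSums_iff] at hv
  rcases hv.le.eq_or_lt with rfl | hab
  · rwa [hv.eq_zero]
  obtain ⟨c, w, hac, hw, rfl⟩ := hv.exists_cons hab
  have hmem : a ∈ Icc a b := ⟨le_rfl, hab.le⟩
  have hsub : nhdsWithin a (Ioo a c) ≤ nhdsWithin a (Icc a b) :=
    nhdsWithin_mono _ fun u hu => ⟨hu.1.le, hu.2.le.trans hw.le⟩
  have hlim : Filter.Tendsto (fun u => ‖x c - x u‖ ^ p + w) (nhdsWithin a (Ioo a c))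
      (nhds (‖x c - x a‖ ^ p + w)) :=
    (((((hx a hmem).mono_left hsub).const_sub _).norm).rpow_const (Or.inr hp.le)).add_const _
  have := left_nhdsWithin_Ioo_neBot hac
  refine le_of_tendsto_of_tendsto hlim ((hf a hmem).mono_left hsub)
    (eventually_nhdsWithin_of_forall fun u hu => ?_)
  have hub := hu.2.le.trans hw.le
  exact (((VariationSum.single hu.2).append hw).le_powVar
    (hfin.mono hu.1.le le_rfl)).trans (h u hu.1 hub)

end VariationSums

section YoungEstimate

variable {E : Type*} [NormedAddCommGroup E]

/-- The constant in `discrete_sewing`. -/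
def sewingConst (θ : ℝ) : ℝ := 2 / (1 - 2 ^ (1 - θ))

theorem one_sub_two_rpow_pos {θ : ℝ} (hθ : 1 < θ) : 0 < 1 - (2 : ℝ) ^ (1 - θ) :=
  sub_pos.2 (Real.rpow_lt_one_of_one_lt_of_neg one_lt_two (by linarith))

theorem sewingConst_nonneg {θ : ℝ} (hθ : 1 < θ) : 0 ≤ sewingConst θ :=
  div_nonneg zero_le_two (one_sub_two_rpow_pos hθ).le

theorem discrete_sewing {g : ℕ → ℕ → E} {w : ℕ → ℕ → ℝ} {M θ : ℝ} {N : ℕ} (hθ : 1 < θ)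
    (hM : 0 ≤ M) (hw0 : ∀ i j, 0 ≤ w i j)
    (hw : ∀ i j k, i ≤ j → j ≤ k → k ≤ N → w i j + w j k ≤ w i k) (hg0 : ∀ i, g i i = 0)
    (hg : ∀ i j k, i ≤ j → j ≤ k → k ≤ N → ‖g i k - g i j - g j k‖ ≤ M * w i k ^ θ)
    (n i : ℕ) (hn : i + n ≤ N) :
    ‖∑ j ∈ Finset.range n, g (i + j) (i + j + 1) - g i (i + n)‖ ≤
      sewingConst θ * (M * w i (i + n) ^ θ) := by
  have hK := sewingConst_nonneg hθ
  induction n using Nat.strong_induction_on generalizing i with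
  | _ n ih =>
  rcases Nat.eq_zero_or_pos n with rfl | hpos
  · simpa [hg0] using mul_nonneg hK (mul_nonneg hM (Real.rpow_nonneg (hw0 i i) θ))
  set W := w i (i + n) with hW
  have hW0 : 0 ≤ W := hw0 _ _
  have hdiag : ∀ j, j ≤ N → w j j ≤ 0 := fun j hj => by
    linarith [hw j j j le_rfl le_rfl hj]
  obtain ⟨m, hmn, hm₁, hm₂⟩ : ∃ m < n, w i (i + m) ≤ W / 2 ∧ w (i + m + 1) (i + n) ≤ W / 2 := by
    classical
    have hex : ∃ m, n ≤ m ∨ W / 2 < w i (i + m) := ⟨n, Or.inl le_rfl⟩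
    have hspec := Nat.find_spec hex
    obtain ⟨m, hm⟩ : ∃ m, Nat.find hex = m + 1 := by
      refine Nat.exists_eq_succ_of_ne_zero fun h0 => ?_
      rw [h0] at hspec
      rcases hspec with h | h
      · omega
      · have := hdiag i (by omega)
        simp only [add_zero] at h
        linarith
    have hmin := Nat.find_min hex (m := m) (by omega)
    push Not at hmin
    refine ⟨m, hmin.1, hmin.2, ?_⟩
    rw [hm] at hspec
    rcases hspec with h | h
    · have : i + m + 1 = i + n := by omega
      rw [this]
      linarith [hdiag (i + n) hn]
    · rw [← add_assoc] at h
      linarith [hw i (i + m + 1) (i + n) (by omega) (by omega) hn]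
  obtain ⟨r, rfl⟩ : ∃ r, n = m + 1 + r := ⟨n - (m + 1), by omega⟩
  have h₁ := ih m hmn i (by omega)
  have h₂ := ih r (by omega) (i + m + 1) (by omega)
  have h₃ : ‖g i (i + (m + 1 + r)) - g i (i + m) - g (i + m) (i + (m + 1 + r))‖ ≤ M * W ^ θ :=
    hg i (i + m) (i + (m + 1 + r)) (by omega) (by omega) hn
  have h₄ := hg (i + m) (i + m + 1) (i + (m + 1 + r)) (by omega) (by omega) hn
  have h₅ : w (i + m) (i + (m + 1 + r)) ≤ W := by
    linarith [hw i (i + m) (i + (m + 1 + r)) (by omega) (by omega) hn, hw0 i (i + m)]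
  have e : i + m + 1 + r = i + (m + 1 + r) := by omega
  rw [e] at h₂
  have hhalf : (W / 2) ^ θ = W ^ θ * 2 ^ (1 - θ) / 2 := by
    rw [Real.div_rpow hW0 zero_le_two, Real.rpow_sub two_pos, Real.rpow_one]
    field_simp
  have hKeq : sewingConst θ * (M * W ^ θ) =
      sewingConst θ * (M * (W / 2) ^ θ) + sewingConst θ * (M * (W / 2) ^ θ) + M * W ^ θ
        + M * W ^ θ := by
    have := (one_sub_two_rpow_pos hθ).ne'
    rw [hhalf, sewingConst]
    field_simp
    ring
  have b₁ : sewingConst θ * (M * w i (i + m) ^ θ) ≤ sewingConst θ * (M * (W / 2) ^ θ) := by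
    have := hw0 i (i + m)
    gcongr
  have b₂ : sewingConst θ * (M * w (i + m + 1) (i + (m + 1 + r)) ^ θ) ≤
      sewingConst θ * (M * (W / 2) ^ θ) := by
    have := hw0 (i + m + 1) (i + (m + 1 + r))
    gcongr
  have b₃ : M * w (i + m) (i + (m + 1 + r)) ^ θ ≤ M * W ^ θ := by
    have := hw0 (i + m) (i + (m + 1 + r))
    gcongr
  rw [hKeq, Finset.sum_range_add, Finset.sum_range_succ]
  simp only [← add_assoc] at *
  set S₁ := ∑ j ∈ Finset.range m, g (i + j) (i + j + 1)
  set S₂ := ∑ j ∈ Finset.range r, g (i + m + 1 + j) (i + m + 1 + j + 1)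
  have split : S₁ + g (i + m) (i + m + 1) + S₂ - g i (i + m + 1 + r) =
      (S₁ - g i (i + m)) + (S₂ - g (i + m + 1) (i + m + 1 + r))
        - (g i (i + m + 1 + r) - g i (i + m) - g (i + m) (i + m + 1 + r))
        - (g (i + m) (i + m + 1 + r) - g (i + m) (i + m + 1)
          - g (i + m + 1) (i + m + 1 + r)) := by abel
  rw [split]
  refine (norm_sub_le _ _).trans (add_le_add ((norm_sub_le _ _).trans
    (add_le_add ((norm_add_le _ _).trans (add_le_add ?_ ?_)) ?_)) ?_)
  · exact h₁.trans b₁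
  · exact h₂.trans b₂
  · exact h₃
  · exact h₄.trans b₃

variable [NormedSpace ℝ E] {p q : ℝ} {y : ℝ → E} {ω : ℝ → ℝ} {a b : ℝ}

/-- The constant in the Young–Loève estimate. -/
def youngConst (p q : ℝ) : ℝ := sewingConst (1 / p + 1 / q) * 2 ^ (1 / p + 1 / q)

theorem youngConst_nonneg (hθ : 1 < 1 / p + 1 / q) : 0 ≤ youngConst p q :=
  mul_nonneg (sewingConst_nonneg hθ) (by positivity)

/-- Young's maximal inequality for left-point Riemann–Stieltjes sums. -/
theorem young_sum_le (hp : 0 < p) (hq : 0 < q) (hθ : 1 < 1 / p + 1 / q)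
    (hy : FinitePVar q y a b) (hω : FinitePVar p ω a b) {n : ℕ} {t : ℕ → ℝ} (ht : Monotone t)
    (h0 : t 0 = a) (hn : t n = b) :
    ‖∑ j ∈ Finset.range n, (ω (t (j + 1)) - ω (t j)) • y (t j) - (ω b - ω a) • y a‖ ≤
      youngConst p q * (powVar q y a b ^ (1 / q) * powVar p ω a b ^ (1 / p)) := by
  have mem : ∀ {j}, j ≤ n → a ≤ t j ∧ t j ≤ b := fun hj =>
    ⟨h0 ▸ ht (Nat.zero_le _), hn ▸ ht hj⟩
  set Vy := powVar q y a b
  set Vω := powVar p ω a b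
  have hVy : 0 ≤ Vy := powVar_nonneg
  have hVω : 0 ≤ Vω := powVar_nonneg
  set w : ℕ → ℕ → ℝ := fun i j => powVar q y (t i) (t j) / Vy + powVar p ω (t i) (t j) / Vω
  have hw0 : ∀ i j, 0 ≤ w i j := fun i j => by
    have := powVar_nonneg (p := q) (x := y) (a := t i) (b := t j)
    have := powVar_nonneg (p := p) (x := ω) (a := t i) (b := t j)
    positivity
  have aux : ∀ {V v : ℝ}, 0 ≤ v → v ≤ V → v ≤ V * (v / V) := fun {V v} h h' => by
    rcases h.eq_or_lt with rfl | h
    · simp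
    · rw [mul_div_cancel₀ _ (h.trans_le h').ne']
  have key := discrete_sewing (g := fun i j => (ω (t j) - ω (t i)) • y (t i)) (w := w)
    (M := Vy ^ (1 / q) * Vω ^ (1 / p)) (N := n) hθ (by positivity) hw0
    (fun i j k hij hjk hk => by
      have h₁ := powVar_add_le (hy.mono (mem (hij.trans (hjk.trans hk))).1 (mem hk).2)
        (ht hij) (ht hjk)
      have h₂ := powVar_add_le (hω.mono (mem (hij.trans (hjk.trans hk))).1 (mem hk).2)
        (ht hij) (ht hjk)
      have h₁' := div_le_div_of_nonneg_right h₁ hVy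
      have h₂' := div_le_div_of_nonneg_right h₂ hVω
      rw [add_div] at h₁' h₂'
      simp only [w]
      linarith)
    (fun i => by simp)
    (fun i j k hij hjk hk => by
      have hj := hjk.trans hk
      have hi := hij.trans hj
      have hyk := hy.mono (mem hi).1 (mem hk).2
      have hωk := hω.mono (mem hi).1 (mem hk).2
      have e : (ω (t k) - ω (t i)) • y (t i) - (ω (t j) - ω (t i)) • y (t i)
          - (ω (t k) - ω (t j)) • y (t j) = -((ω (t k) - ω (t j)) • (y (t j) - y (t i))) := by
        module
      have b₁ : ‖y (t j) - y (t i)‖ ≤ (Vy * w i k) ^ (1 / q) := by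
        refine (norm_sub_le_powVar hq (hy.mono (mem hi).1 (mem hj).2) (ht hij)).trans ?_
        refine Real.rpow_le_rpow powVar_nonneg ?_ (by positivity)
        refine (powVar_mono hyk le_rfl (ht hij) (ht hjk)).trans ((aux powVar_nonneg
          (powVar_mono hy (mem hi).1 (ht (hij.trans hjk)) (mem hk).2)).trans ?_)
        exact mul_le_mul_of_nonneg_left (le_add_of_nonneg_right
          (div_nonneg powVar_nonneg hVω)) hVy
      have b₂ : ‖ω (t k) - ω (t j)‖ ≤ (Vω * w i k) ^ (1 / p) := by
        refine (norm_sub_le_powVar hp (hω.mono (mem hj).1 (mem hk).2) (ht hjk)).trans ?_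
        refine Real.rpow_le_rpow powVar_nonneg ?_ (by positivity)
        refine (powVar_mono hωk (ht hij) (ht hjk) le_rfl).trans ((aux powVar_nonneg
          (powVar_mono hω (mem hi).1 (ht (hij.trans hjk)) (mem hk).2)).trans ?_)
        exact mul_le_mul_of_nonneg_left (le_add_of_nonneg_left
          (div_nonneg powVar_nonneg hVy)) hVω
      rw [e, norm_neg, norm_smul]
      refine (mul_le_mul b₂ b₁ (norm_nonneg _)
        (Real.rpow_nonneg (mul_nonneg hVω (hw0 i k)) _)).trans_eq ?_
      rw [Real.mul_rpow hVω (hw0 i k), Real.mul_rpow hVy (hw0 i k),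
        Real.rpow_add_of_nonneg (hw0 i k) (by positivity) (by positivity)]
      ring)
    n 0 (by simp)
  simp only [zero_add, h0, hn] at key
  refine key.trans ?_
  have hw2 : w 0 n ≤ 2 := by
    simp only [w, h0, hn]
    linarith [div_self_le_one Vy, div_self_le_one Vω]
  have := hw0 0 n
  have := sewingConst_nonneg hθ
  calc _ ≤ sewingConst (1 / p + 1 / q) *
        (Vy ^ (1 / q) * Vω ^ (1 / p) * 2 ^ (1 / p + 1 / q)) := by gcongr
    _ = _ := by rw [youngConst]; ring

/-- The equidistant partition into `n + 1` pieces, tagged by left endpoints. -/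
def uniformPartition (hab : a < b) (n : ℕ) : TaggedPartition a b where
  n := n + 1
  t i := a + (i : ℕ) * ((b - a) / (n + 1))
  tag i := a + (i : ℕ) * ((b - a) / (n + 1))
  mono i j hij := by
    have : 0 < (b - a) / (n + 1) := div_pos (sub_pos.2 hab) (by positivity)
    have : ((i : ℕ) : ℝ) < (j : ℕ) := by exact_mod_cast hij
    dsimp only
    gcongr
  first := by simp
  last := by
    simp only [Fin.val_last]
    push_cast
    field_simp
    ring
  tag_mem i := by
    have : 0 < (b - a) / (n + 1) := div_pos (sub_pos.2 hab) (by positivity)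
    constructor
    · simp
    · simp only [Fin.val_succ]
      push_cast
      linarith

theorem uniformPartition_mesh_le (hab : a < b) (n : ℕ) :
    (uniformPartition hab n).mesh ≤ (b - a) / (n + 1) := by
  have : 0 < (b - a) / (n + 1) := div_pos (sub_pos.2 hab) (by positivity)
  refine Real.iSup_le (fun i => ?_) this.le
  change a + ((i.val + 1 : ℕ) : ℝ) * ((b - a) / (n + 1)) - (a + (i.val : ℝ) * ((b - a) / (n + 1)))
    ≤ (b - a) / (n + 1)
  push_cast
  linarith

/-- The Young–Loève estimate. -/
theorem norm_youngIntegral_le (hp : 0 < p) (hq : 0 < q) (hθ : 1 < 1 / p + 1 / q)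
    (hab : a < b) (hy : FinitePVar q y a b) (hω : FinitePVar p ω a b) :
    ‖youngIntegral (fun u => ContinuousLinearMap.toSpanSingleton ℝ (y u)) ω a b‖ ≤
      |ω b - ω a| * ‖y a‖ +
        youngConst p q * (powVar q y a b ^ (1 / q) * powVar p ω a b ^ (1 / p)) := by
  have hK := youngConst_nonneg hθ
  have hVy : 0 ≤ powVar q y a b := powVar_nonneg
  have hVω : 0 ≤ powVar p ω a b := powVar_nonneg
  unfold youngIntegral
  split_ifs with hv
  swap
  · rw [norm_zero]
    positivity
  refine le_of_forall_pos_le_add fun ε hε => ?_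
  obtain ⟨δ, hδ, h⟩ := hv.choose_spec ε hε
  obtain ⟨n, hn⟩ := exists_nat_gt ((b - a) / δ)
  have hmesh : (uniformPartition hab n).mesh < δ := by
    refine (uniformPartition_mesh_le hab n).trans_lt ?_
    rw [div_lt_iff₀ (by positivity)]
    rw [div_lt_iff₀ hδ] at hn
    linarith
  have hI := h _ hmesh
  have hpos : 0 < (b - a) / (n + 1) := div_pos (sub_pos.2 hab) (by positivity)
  have hS := young_sum_le hp hq hθ hy hω (n := n + 1)
    (t := fun i => a + (i : ℕ) * ((b - a) / (n + 1)))
    (fun i j hij => by dsimp only; gcongr) (by simp) (by push_cast; field_simp; ring)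
  have hsum : RSSum (fun u => ContinuousLinearMap.toSpanSingleton ℝ (y u)) ω
      (uniformPartition hab n) = ∑ j ∈ Finset.range (n + 1),
        (ω (a + ((j + 1 : ℕ) : ℝ) * ((b - a) / (n + 1))) - ω (a + (j : ℝ) * ((b - a) / (n + 1)))) •
          y (a + (j : ℝ) * ((b - a) / (n + 1))) := by
    rw [Finset.sum_range]
    simp [RSSum, uniformPartition]
    rfl
  rw [← hsum] at hS
  set R := RSSum (fun u => ContinuousLinearMap.toSpanSingleton ℝ (y u)) ω (uniformPartition hab n)
  have e : hv.choose = (ω b - ω a) • y a + (R - (ω b - ω a) • y a) - (R - hv.choose) := by abel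
  rw [e]
  refine (norm_sub_le _ _).trans (add_le_add ((norm_add_le _ _).trans (add_le_add ?_ hS)) hI.le)
  rw [norm_smul, Real.norm_eq_abs]

end YoungEstimate

section Gronwall

/-- Splits an interval at a balanced point of a superadditive functional. -/
theorem exists_balanced_point {w : ℝ → ℝ → ℝ} {s t : ℝ} (hst : s ≤ t)
    (hw0 : ∀ u v, 0 ≤ w u v)
    (hw : ∀ u v r, s ≤ u → u ≤ v → v ≤ r → r ≤ t → w u v + w v r ≤ w u r) :
    ∃ m ∈ Icc s t, (∀ u, s ≤ u → u < m → w s u ≤ w s t / 2) ∧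
      ∀ u, m < u → u ≤ t → w u t ≤ w s t / 2 := by
  set U := {u | u ∈ Icc s t ∧ w s u ≤ w s t / 2} with hU
  have hs : s ∈ U := ⟨⟨le_rfl, hst⟩, by
    linarith [hw s s s le_rfl le_rfl le_rfl hst, hw0 s t]⟩
  have hbdd : BddAbove U := ⟨t, fun u hu => hu.1.2⟩
  refine ⟨sSup U, ⟨le_csSup hbdd hs, csSup_le ⟨s, hs⟩ fun u hu => hu.1.2⟩, ?_, ?_⟩
  · intro u hu hlt
    obtain ⟨v, hv, huv⟩ := exists_lt_of_lt_csSup ⟨s, hs⟩ hlt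
    linarith [hw s u v le_rfl hu huv.le hv.1.2, hv.2, hw0 u v]
  · intro u hlt hut
    have hsu : s ≤ u := (le_csSup hbdd hs).trans hlt.le
    have : u ∉ U := fun h => not_lt.2 (le_csSup hbdd h) hlt
    have : w s t / 2 < w s u := by
      by_contra! h
      exact this ⟨⟨hsu, hut⟩, h⟩
    linarith [hw s u t le_rfl hsu hut le_rfl]

variable {E : Type*} [NormedAddCommGroup E]

/-- A bound of the variation on short intervals propagates to all intervals, with growth
exponential in the size of the interval. -/
theorem powVar_root_le_of_short {q ε M T : ℝ} (hq : 1 ≤ q) (hM : 0 ≤ M)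
    {x : ℝ → E} {w : ℝ → ℝ → ℝ} (hx : ContinuousOn x (Icc 0 T)) (hfin : FinitePVar q x 0 T)
    (hw0 : ∀ u v, 0 ≤ w u v)
    (hw : ∀ u v r, 0 ≤ u → u ≤ v → v ≤ r → r ≤ T → w u v + w v r ≤ w u r)
    (hshort : ∀ s t, 0 ≤ s → s ≤ t → t ≤ T → w s t ≤ ε →
      powVar q x s t ^ (1 / q) ≤ M + ‖x s‖)
    (n : ℕ) (s t : ℝ) (hs : 0 ≤ s) (hst : s ≤ t) (ht : t ≤ T) (hn : w s t ≤ 2 ^ n * ε) :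
    powVar q x s t ^ (1 / q) ≤ (M + ‖x s‖) * (2 ^ 2 ^ n - 1) := by
  have hq0 : 0 < q := by linarith
  induction n generalizing s t with
  | zero =>
    refine (hshort s t hs hst ht (by simpa using hn)).trans_eq ?_
    norm_num
  | succ n ih =>
    obtain ⟨m, ⟨hsm, hmt⟩, hl, hr⟩ := exists_balanced_point hst hw0
      (fun u v r hu huv hvr hr => hw u v r (hs.trans hu) huv hvr (hr.trans ht))
    have hF : (0 : ℝ) ≤ 2 ^ 2 ^ n - 1 := sub_nonneg.2 (one_le_pow₀ one_le_two)
    set F : ℝ := 2 ^ 2 ^ n - 1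
    have hhalf : w s t / 2 ≤ 2 ^ n * ε := by
      rw [pow_succ] at hn
      linarith
    have root : ∀ {V B : ℝ}, 0 ≤ V → 0 ≤ B → (V ^ (1 / q) ≤ B ↔ V ≤ B ^ q) := fun hV hB => by
      rw [one_div, Real.rpow_inv_le_iff_of_pos hV hB hq0]
    have hleft : powVar q x s m ^ (1 / q) ≤ (M + ‖x s‖) * F := by
      rw [root powVar_nonneg (by positivity)]
      refine powVar_le_of_forall_lt hq0 (hx.mono (Icc_subset_Icc hs (hmt.trans ht)))
        (hfin.mono hs (hmt.trans ht)) (by positivity) fun u hu hum => ?_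
      rw [← root powVar_nonneg (by positivity)]
      exact ih s u hs hu (hum.le.trans (hmt.trans ht)) ((hl u hu hum).trans hhalf)
    have hright : powVar q x m t ^ (1 / q) ≤ (M + ‖x m‖) * F := by
      have hxm : ContinuousOn x (Icc m t) := hx.mono (Icc_subset_Icc (hs.trans hsm) ht)
      rw [root powVar_nonneg (by positivity)]
      refine powVar_le_of_forall_gt (f := fun u => ((M + ‖x u‖) * F) ^ q) hq0 hxm
        (hfin.mono (hs.trans hsm) ht) ?_ (by positivity) fun u hu hut => ?_
      · exact ((continuousOn_const.add hxm.norm).mul continuousOn_const).rpow_const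
          fun _ _ => Or.inr hq0.le
      rw [← root powVar_nonneg (by positivity)]
      exact ih u t (hs.trans (hsm.trans hu.le)) hut ht ((hr u hu hut).trans hhalf)
    have hxm : ‖x m‖ ≤ ‖x s‖ + (M + ‖x s‖) * F := by
      have h₁ := norm_sub_le_powVar hq0 (hfin.mono hs (hmt.trans ht)) hsm
      have h₂ := norm_le_norm_add_norm_sub' (x m) (x s)
      linarith
    calc _ ≤ _ := powVar_root_le_append hq (hfin.mono hs ht) hsm hmt
      _ ≤ (M + ‖x s‖) * F + (M + (‖x s‖ + (M + ‖x s‖) * F)) * F := by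
        refine add_le_add hleft (hright.trans ?_)
        gcongr
      _ = _ := by
        simp only [F, pow_succ (2 : ℕ) n, pow_mul]
        ring

theorem powVar_root_le_exp {q ε M T : ℝ} (hq : 1 ≤ q) (hM : 0 ≤ M) (hε : 0 < ε)
    {x : ℝ → E} {w : ℝ → ℝ → ℝ} (hx : ContinuousOn x (Icc 0 T)) (hfin : FinitePVar q x 0 T)
    (hw0 : ∀ u v, 0 ≤ w u v)
    (hw : ∀ u v r, 0 ≤ u → u ≤ v → v ≤ r → r ≤ T → w u v + w v r ≤ w u r)
    (hshort : ∀ s t, 0 ≤ s → s ≤ t → t ≤ T → w s t ≤ ε →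
      powVar q x s t ^ (1 / q) ≤ M + ‖x s‖)
    {s t : ℝ} (hs : 0 ≤ s) (hst : s ≤ t) (ht : t ≤ T) :
    powVar q x s t ^ (1 / q) ≤ (M + ‖x s‖) * Real.exp (2 / ε * w s t) := by
  have hwst := hw0 s t
  have hxs := norm_nonneg (x s)
  by_cases h : w s t ≤ ε
  · refine (hshort s t hs hst ht h).trans (le_mul_of_one_le_right (by positivity) ?_)
    exact Real.one_le_exp (by positivity)
  push Not at h
  obtain ⟨n, hn₁, hn₂⟩ := exists_nat_pow_near (x := w s t / ε) (y := 2)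
    ((one_le_div hε).2 h.le) one_lt_two
  rw [div_lt_iff₀ hε] at hn₂
  refine (powVar_root_le_of_short hq hM hx hfin hw0 hw hshort (n + 1) s t hs hst ht hn₂.le).trans ?_
  gcongr
  have h2 : (2 : ℝ) ≤ Real.exp 1 := by linarith [Real.add_one_le_exp 1]
  calc (2 : ℝ) ^ 2 ^ (n + 1) - 1 ≤ 2 ^ 2 ^ (n + 1) := by linarith
    _ ≤ Real.exp 1 ^ 2 ^ (n + 1) := by gcongr
    _ = Real.exp (2 ^ (n + 1)) := by rw [← Real.exp_nat_mul]; push_cast; rw [mul_one]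
    _ ≤ _ := by
      rw [Real.exp_le_exp, pow_succ]
      calc (2 : ℝ) ^ n * 2 ≤ w s t / ε * 2 := by gcongr
        _ = _ := by ring

theorem length_rpow_add_powVar_superadditive {p : ℝ} (hp : 1 ≤ p) {x : ℝ → E} {u v r : ℝ}
    (hx : FinitePVar p x u r) (huv : u ≤ v) (hvr : v ≤ r) :
    |v - u| ^ p + powVar p x u v + (|r - v| ^ p + powVar p x v r) ≤
      |r - u| ^ p + powVar p x u r := by
  have h₁ := powVar_add_le hx huv hvr
  have h₂ := Real.add_rpow_le_rpow_add (abs_nonneg (v - u)) (abs_nonneg (r - v)) hp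
  have : |v - u| + |r - v| = |r - u| := by
    rw [abs_of_nonneg, abs_of_nonneg, abs_of_nonneg] <;> linarith
  rw [this] at h₂
  linarith

theorem pVar_rpow_eq_powVar {p : ℝ} (hp : 0 < p)
    {x : ℝ → E} {a b : ℝ} : pVar p x a b ^ p = powVar p x a b := by
  have : pVar p x a b = powVar p x a b ^ (1 / p) := rfl
  rw [this, ← Real.rpow_mul powVar_nonneg, one_div_mul_cancel hp.ne', Real.rpow_one]

variable [NormedSpace ℝ E]

theorem powVar_root_le_of_integral_bound {p q a1 a2 T A₀ : ℝ} (hp : 1 ≤ p) (hpq : p ≤ q)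
    (hθ : 1 < 1 / p + 1 / q) (ha1 : 0 ≤ a1) (ha2 : 0 ≤ a2)
    {ω : ℝ → ℝ} {y : ℝ → E} {A : ℝ → ℝ → ℝ}
    (hω : FinitePVar p ω 0 T) (hy : FinitePVar q y 0 T)
    (hA : IsControlOn 0 T A) (hA₀ : A 0 T ^ (1 / q) = A₀)
    (h : ∀ s t : ℝ, 0 ≤ s → s < t → t ≤ T →
        ‖y t - y s‖ ≤ A s t ^ (1 / q) + a1 * ‖∫ u in s..t, y u‖ +
          a2 * ‖youngIntegral (fun u => ContinuousLinearMap.toSpanSingleton ℝ (y u)) ω s t‖)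
    {s t : ℝ} (hs : 0 ≤ s) (hst : s ≤ t) (ht : t ≤ T)
    (hshort : (a1 + a2 * (1 + youngConst p q)) *
      (|t - s| ^ p + powVar p ω s t) ^ (1 / p) ≤ 1 / 2) :
    powVar q y s t ^ (1 / q) ≤ 2 * A₀ + ‖y s‖ := by
  obtain ⟨-, -, hAadd, hApos⟩ := hA
  have hp0 : 0 < p := by linarith
  have hq0 : 0 < q := by linarith
  have hK := youngConst_nonneg hθ
  set k := a1 + a2 * (1 + youngConst p q)
  have hk : 0 ≤ k := by positivity
  set w : ℝ → ℝ → ℝ := fun u v => |v - u| ^ p + powVar p ω u v with hwdef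
  have hw0 : ∀ u v, 0 ≤ w u v := fun u v =>
    add_nonneg (by positivity) powVar_nonneg
  have hys : FinitePVar q y s t := hy.mono hs ht
  set V := powVar q y s t ^ (1 / q) with hV
  have hV0 : 0 ≤ V := Real.rpow_nonneg powVar_nonneg _
  set D := ‖y s‖ + V with hD
  have hD0 : 0 ≤ D := by positivity
  have hyD : ∀ r, s ≤ r → r ≤ t → ‖y r‖ ≤ D := fun r hr hrt => by
    have h₁ := norm_sub_le_powVar hq0 (hys.mono le_rfl hrt) hr
    have h₂ : powVar q y s r ^ (1 / q) ≤ V :=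
      Real.rpow_le_rpow powVar_nonneg (powVar_mono hys le_rfl hr hrt) (by positivity)
    have h₃ := norm_le_norm_add_norm_sub' (y r) (y s)
    linarith
  have hwadd : ∀ u v r, s ≤ u → u ≤ v → v ≤ r → r ≤ t → w u v + w v r ≤ w u r :=
    fun u v r hu huv hvr hr => length_rpow_add_powVar_superadditive hp
      (hω.mono (hs.trans hu) (hr.trans ht)) huv hvr
  have root : ∀ {z : ℝ}, 0 ≤ z → (z ^ q) ^ (1 / q) = z := fun hz => by
    rw [← Real.rpow_mul hz, mul_one_div_cancel hq0.ne', Real.rpow_one]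
  set W : ℝ → ℝ → ℝ := fun u v => (D * k * w u v ^ (1 / p)) ^ q with hW
  have hWroot : ∀ u v, W u v ^ (1 / q) = D * k * w u v ^ (1 / p) := fun u v =>
    root (mul_nonneg (mul_nonneg hD0 hk) (Real.rpow_nonneg (hw0 u v) _))
  have hWeq : ∀ u v, W u v = (D * k) ^ q * w u v ^ (q / p) := fun u v => by
    simp only [hW]
    rw [Real.mul_rpow (by positivity) (Real.rpow_nonneg (hw0 u v) _), ← Real.rpow_mul (hw0 u v),
      one_div_mul_eq_div]
  have key := powVar_root_le_add (x := y) (hp.trans hpq) (W₁ := A) (W₂ := W) hst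
    (fun u v hu huv hv => hApos u v (hs.trans hu) huv (hv.trans ht))
    (fun u v _ _ _ => Real.rpow_nonneg (mul_nonneg (mul_nonneg hD0 hk)
      (Real.rpow_nonneg (hw0 u v) _)) _)
    (fun u v hu huv hv => hAadd s u v hs hu huv (hv.trans ht))
    (fun u v hu huv hv => by
      have h₁ := Real.add_rpow_le_rpow_add (hw0 s u) (hw0 u v) ((one_le_div hp0).2 hpq)
      have h₂ := Real.rpow_le_rpow (add_nonneg (hw0 s u) (hw0 u v))
        (hwadd s u v le_rfl hu huv hv) (div_pos hq0 hp0).le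
      rw [hWeq, hWeq, hWeq, ← mul_add]
      exact mul_le_mul_of_nonneg_left (h₁.trans h₂) (by positivity))
    (fun u v hu huv hv => by
      rw [hWroot]
      have hu0 := hs.trans hu
      have hvT := hv.trans ht
      have hωuv := hω.mono hu0 hvT
      have hr₁ : |v - u| ≤ w u v ^ (1 / p) := by
        rw [one_div, Real.le_rpow_inv_iff_of_pos (abs_nonneg _) (hw0 u v) hp0]
        exact le_add_of_nonneg_right powVar_nonneg
      have hr₂ : powVar p ω u v ^ (1 / p) ≤ w u v ^ (1 / p) :=
        Real.rpow_le_rpow powVar_nonneg (le_add_of_nonneg_left (by positivity)) (by positivity)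
      have hr₃ := norm_sub_le_powVar hp0 hωuv huv.le
      have hr₄ : powVar q y u v ^ (1 / q) ≤ D :=
        (Real.rpow_le_rpow powVar_nonneg (powVar_mono hys hu huv.le hv)
          (by positivity)).trans (by linarith [norm_nonneg (y s)])
      have hI : ‖∫ r in u..v, y r‖ ≤ D * w u v ^ (1 / p) := by
        refine (intervalIntegral.norm_integral_le_of_norm_le_const (C := D) fun r hr => ?_).trans ?_
        · rw [uIoc_of_le huv.le] at hr
          exact hyD r (hu.trans hr.1.le) (hr.2.trans hv)
        · gcongr
      have hY := norm_youngIntegral_le hp0 hq0 hθ huv (hy.mono hu0 hvT) hωuv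
      have hY' : ‖youngIntegral (fun r => ContinuousLinearMap.toSpanSingleton ℝ (y r)) ω u v‖ ≤
          (1 + youngConst p q) * (D * w u v ^ (1 / p)) := by
        refine hY.trans ?_
        have hyu := hyD u hu (huv.le.trans hv)
        rw [Real.norm_eq_abs] at hr₃
        have hρ : 0 ≤ w u v ^ (1 / p) := Real.rpow_nonneg (hw0 u v) _
        have hρ' : 0 ≤ powVar p ω u v ^ (1 / p) := Real.rpow_nonneg powVar_nonneg _
        calc _ ≤ w u v ^ (1 / p) * D + youngConst p q * (D * w u v ^ (1 / p)) := by
              have := hr₃.trans hr₂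
              gcongr
          _ = _ := by ring
      have := h u v hu0 huv hvT
      have e₁ := mul_le_mul_of_nonneg_left hI ha1
      have e₂ := mul_le_mul_of_nonneg_left hY' ha2
      have e₃ : D * k * w u v ^ (1 / p) = a1 * (D * w u v ^ (1 / p)) +
          a2 * ((1 + youngConst p q) * (D * w u v ^ (1 / p))) := by
        simp only [k]
        ring
      linarith)
  rw [hWroot] at key
  have hAst : A s t ^ (1 / q) ≤ A₀ := by
    rw [← hA₀]
    refine Real.rpow_le_rpow (hApos s t hs hst ht) ?_ (by positivity)
    have hsT := hst.trans ht
    linarith [hAadd 0 s T le_rfl hs hsT le_rfl, hAadd s t T hs hst ht le_rfl,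
      hApos 0 s le_rfl hs hsT, hApos t T (hs.trans hst) ht le_rfl]
  have e : D * k * w s t ^ (1 / p) ≤ D * (1 / 2) := by
    rw [mul_assoc]
    exact mul_le_mul_of_nonneg_left hshort hD0
  linarith

end Gronwall

/-- Gronwall-type Lemma `lemma6`: if
`‖y t - y s‖ ≤ A(s,t)^{1/q} + a₁ ‖∫_s^t y du‖ + a₂ ‖∫_s^t y dω‖` for a control `A` and
constants `a₁, a₂ ≥ 0`, then there is a constant `C` depending only on `p, q, a₁, a₂`
(in particular independent of `T`) such that
`|||y|||_{q-var,[s,t]} ≤ (2 A(0,T)^{1/q} + ‖y s‖) exp(C(|t-s|^p + |||ω|||^p_{p-var,[s,t]}))`. -/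
theorem stmt11 {d : ℕ} (p q a1 a2 : ℝ) (hp : 1 ≤ p) (hpq : p ≤ q)
    (hθ : 1 < 1 / p + 1 / q) (ha1 : 0 ≤ a1) (ha2 : 0 ≤ a2) :
    ∃ C : ℝ, ∀ (T : ℝ) (ω : ℝ → ℝ) (y : ℝ → Ed d) (A : ℝ → ℝ → ℝ),
      0 < T → ContinuousOn ω (Set.Icc 0 T) → FinitePVar p ω 0 T →
      ContinuousOn y (Set.Icc 0 T) → FinitePVar q y 0 T →
      IsControlOn 0 T A →
      (∀ s t : ℝ, 0 ≤ s → s < t → t ≤ T →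
        ‖y t - y s‖ ≤ A s t ^ (1 / q) + a1 * ‖∫ u in s..t, y u‖ +
          a2 * ‖youngIntegral (fun u => ContinuousLinearMap.toSpanSingleton ℝ (y u)) ω s t‖) →
      ∀ s t : ℝ, 0 ≤ s → s < t → t ≤ T →
        pVar q y s t ≤
          (2 * A 0 T ^ (1 / q) + ‖y s‖) *
            Real.exp (C * (|t - s| ^ p + pVar p ω s t ^ p)) := by
  have hp0 : 0 < p := by linarith
  have hq0 : 0 < q := by linarith
  have hK := youngConst_nonneg hθ
  set k := a1 + a2 * (1 + youngConst p q) with hk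
  have hk0 : 0 ≤ k := by positivity
  set ε : ℝ := (1 / (2 * (k + 1))) ^ p with hε
  refine ⟨2 / ε, fun T ω y A hT _ hωfin hy hyfin hA h s t hs hst ht => ?_⟩
  have hA0 : 0 ≤ A 0 T := hA.2.2.2 0 T le_rfl hT.le le_rfl
  rw [pVar_rpow_eq_powVar hp0]
  refine powVar_root_le_exp (w := fun u v => |v - u| ^ p + powVar p ω u v) (hp.trans hpq)
    (by positivity) (by positivity) hy hyfin
    (fun u v => add_nonneg (by positivity) powVar_nonneg) ?_ ?_ hs hst.le ht
  · exact fun u v r hu huv hvr hr => length_rpow_add_powVar_superadditive hp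
      (hωfin.mono hu hr) huv hvr
  · intro s t hs hst ht hsmall
    refine powVar_root_le_of_integral_bound hp hpq hθ ha1 ha2 hωfin hyfin hA rfl h hs hst ht ?_
    have hroot : (|t - s| ^ p + powVar p ω s t) ^ (1 / p) ≤ 1 / (2 * (k + 1)) := by
      rw [one_div p, Real.rpow_inv_le_iff_of_pos
        (add_nonneg (by positivity) powVar_nonneg) (by positivity) hp0]
      exact hsmall
    calc k * (|t - s| ^ p + powVar p ω s t) ^ (1 / p) ≤ k * (1 / (2 * (k + 1))) := by gcongr
      _ ≤ 1 / 2 := by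
        rw [mul_one_div, div_le_div_iff₀ (by positivity) two_pos]
        linarith
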